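/- For every RDF graph G and every graph pattern P, the relational answer ||P||_G equals ||τ(P)||_{triple(G)}: the bag of tuples over var(P) obtained by padding each SPARQL solution mapping in ⟦P⟧_G with null on its unbound variables (keeping multiplicities) coincides with the answer to the translated relational-algebra query τ(P) evaluated over the data instance storing G as the ternary relation triple with attributes sub, pred, obj. -/

import Mathlib

noncomputable section
open Classical

attribute [local instance 10] Classical.propDecidable

namespace RA

variable {A Δ : Type} [DecidableEq A] [DecidableEq Δ]

/-- Three-valued logic: true, false, unknown (error). -/
inductive TV where
  | tt | ff | unk
deriving DecidableEq

/-- Kleene conjunction. -/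
def TV.and : TV → TV → TV
  | .ff, _ => .ff
  | _, .ff => .ff
  | .tt, .tt => .tt
  | _, _ => .unk

/-- Kleene negation. -/
def TV.not : TV → TV
  | .tt => .ff
  | .ff => .tt
  | .unk => .unk

mutual
/-- Terms over attributes `A` and domain `Δ`: attributes, constants and conditionals. -/
inductive Term (A Δ : Type) where
  | attr : A → Term A Δ
  | const : Δ → Term A Δ
  | ite : Filter A Δ → Term A Δ → Term A Δ → Term A Δ

/-- RA filters: `isNull` on a (finite) set of terms, equality, conjunction, negation. -/
inductive Filter (A Δ : Type) where
  | isNull : List (Term A Δ) → Filter A Δ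
  | eq : Term A Δ → Term A Δ → Filter A Δ
  | and : Filter A Δ → Filter A Δ → Filter A Δ
  | not : Filter A Δ → Filter A Δ
end

/-- Disjunction: `F1 ∨ F2 = ¬(¬F1 ∧ ¬F2)`. -/
def Filter.or (F1 F2 : Filter A Δ) : Filter A Δ := .not ((Filter.not F1).and (Filter.not F2))

/-- The tautological filter ⊤ (`isNull` of the empty set of terms is always true). -/
def Filter.tru : Filter A Δ := .isNull []

/-- A tuple over a set of attributes: `none` marks attributes outside the set. -/
abbrev Tuple (A Δ : Type) := A → Option Δ

mutual
/-- Evaluation of a term on a tuple (`null` is the distinguished null value of `Δ`). -/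
def Term.eval (null : Δ) (t : Tuple A Δ) : Term A Δ → Δ
  | .attr a => (t a).getD null
  | .const c => c
  | .ite F v v' => if F.eval null t = TV.tt then v.eval null t else v'.eval null t

def Term.evalList (null : Δ) (t : Tuple A Δ) : List (Term A Δ) → List Δ
  | [] => []
  | v :: vs => v.eval null t :: Term.evalList null t vs

/-- Three-valued evaluation of a filter on a tuple. -/
def Filter.eval (null : Δ) (t : Tuple A Δ) : Filter A Δ → TV
  | .isNull V => if ∀ d ∈ Term.evalList null t V, d = null then .tt else .ff
  | .eq v v' =>
      if v.eval null t = null ∨ v'.eval null t = null then .unk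
      else if v.eval null t = v'.eval null t then .tt else .ff
  | .and F1 F2 => (F1.eval null t).and (F2.eval null t)
  | .not F => (F.eval null t).not
end

mutual
/-- Attributes occurring in a term. -/
def Term.attrs : Term A Δ → Finset A
  | .attr a => {a}
  | .const _ => ∅
  | .ite F v v' => F.attrs ∪ v.attrs ∪ v'.attrs

def Term.attrsList : List (Term A Δ) → Finset A
  | [] => ∅
  | v :: vs => v.attrs ∪ Term.attrsList vs

/-- Attributes occurring in a filter. -/
def Filter.attrs : Filter A Δ → Finset A
  | .isNull V => Term.attrsList V
  | .eq v v' => v.attrs ∪ v'.attrs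
  | .and F1 F2 => F1.attrs ∪ F2.attrs
  | .not F => F.attrs
end

/-- A term is over `U` if all its attributes are in `U`. -/
def Term.over (v : Term A Δ) (U : Finset A) : Prop := v.attrs ⊆ U

/-- A filter is over `U` if all its attributes are in `U`. -/
def Filter.over (F : Filter A Δ) (U : Finset A) : Prop := F.attrs ⊆ U

/-- A tuple is over `U` if its domain is exactly `U`. -/
def Tuple.isOver (t : Tuple A Δ) (U : Finset A) : Prop := ∀ a, (t a).isSome ↔ a ∈ U

/-- A relation is a bag (multiset) of tuples. -/
abbrev Rel (A Δ : Type) := Multiset (Tuple A Δ)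

/-- A relation is over `U` if all its tuples are. -/
def Rel.isOver (R : Rel A Δ) (U : Finset A) : Prop := ∀ t ∈ R, t.isOver U

/-- Selection σ_F. -/
def select (null : Δ) (F : Filter A Δ) (R : Rel A Δ) : Rel A Δ :=
  R.filter (fun t => F.eval null t = .tt)

/-- Restriction of a tuple to the attributes in `U`. -/
def Tuple.restrict (t : Tuple A Δ) (U : Finset A) : Tuple A Δ :=
  fun a => if a ∈ U then t a else none

/-- Projection π_U (bag semantics: multiplicities are added up). -/
def proj (U : Finset A) (R : Rel A Δ) : Rel A Δ := R.map (·.restrict U)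

/-- Bag difference: `(R1 ∖ R2)(t) = R1(t)` if `t ∉ R2` and `0` otherwise. -/
def bdiff (R1 R2 : Rel A Δ) : Rel A Δ := R1.filter (fun t => t ∉ R2)

/-- Compatibility of tuples: equal and non-null on the shared attributes. -/
def Compat (null : Δ) (t1 t2 : Tuple A Δ) : Prop :=
  ∀ a, (t1 a).isSome → (t2 a).isSome → (t1 a = t2 a ∧ t1 a ≠ some null)

/-- `t1 ⊕ t2`: the common extension of two (compatible) tuples. -/
def Tuple.merge (t1 t2 : Tuple A Δ) : Tuple A Δ :=
  fun a => (t1 a).or (t2 a)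

/-- Natural join. -/
def join (null : Δ) (R1 R2 : Rel A Δ) : Rel A Δ :=
  (R1.product R2).filterMap
    (fun p => if Compat null p.1 p.2 then some (p.1.merge p.2) else none)

/-- Natural join with a filter: `R1 ⋈_F R2 = σ_F (R1 ⋈ R2)`. -/
def joinF (null : Δ) (F : Filter A Δ) (R1 R2 : Rel A Δ) : Rel A Δ :=
  select null F (join null R1 R2)

/-- Padding of a tuple with `null` on the attributes of `V`. -/
def Tuple.pad (null : Δ) (V : Finset A) (t : Tuple A Δ) : Tuple A Δ :=
  fun a => if a ∈ V then (t a).or (some null) else t a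

/-- Outer union of `R1` over `U1` and `R2` over `U2`:
each relation is padded with nulls on the attributes missing from it. -/
def ounion (null : Δ) (U1 U2 : Finset A) (R1 R2 : Rel A Δ) : Rel A Δ :=
  R1.map (Tuple.pad null (U2 \ U1)) + R2.map (Tuple.pad null (U1 \ U2))

/-- Left join `R1 ⟕_F R2 = (R1 ⋈_F R2) ⊎ (R1 ∖ π_{U1}(R1 ⋈_F R2))`
for `R1` over `U1` and `R2` over `U2`. -/
def ljoin (null : Δ) (U1 U2 : Finset A) (F : Filter A Δ) (R1 R2 : Rel A Δ) : Rel A Δ :=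
  ounion null (U1 ∪ U2) U1 (joinF null F R1 R2) (bdiff R1 (proj U1 (joinF null F R1 R2)))

/-- Natural left join `R1 ⟕ R2 = R1 ⟕_⊤ R2`. -/
def nljoin (null : Δ) (U1 U2 : Finset A) (R1 R2 : Rel A Δ) : Rel A Δ :=
  ljoin null U1 U2 Filter.tru R1 R2

/-- Extension ν_{u↦v}. -/
def extend (null : Δ) (u : A) (v : Term A Δ) (R : Rel A Δ) : Rel A Δ :=
  R.map (fun t a => if a = u then some (v.eval null t) else t a)

/-- Duplicate elimination δ. -/
def dedup (R : Rel A Δ) : Rel A Δ := R.dedup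

/-- Extended renaming ρ^V_{{u/f(u) | u ∈ S}} at the level of tuples:
each attribute `u ∈ S` receives the value of the term `f u` (evaluated on the original
tuple) and the attributes of `V ∖ S` are projected away. -/
def renameFun (null : Δ) (V S : Finset A) (f : A → Term A Δ) (t : Tuple A Δ) : Tuple A Δ :=
  fun a => if a ∈ S then some ((f a).eval null t) else if a ∈ V then none else t a

/-- Extended renaming ρ^V_{{u/f(u) | u ∈ S}}. -/
def rename (null : Δ) (V S : Finset A) (f : A → Term A Δ) (R : Rel A Δ) : Rel A Δ :=
  R.map (renameFun null V S f)

/-- Renaming of the attribute `uold` into `unew` at the level of tuples. -/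
def renameAttrT (unew uold : A) (t : Tuple A Δ) : Tuple A Δ :=
  fun a => if a = unew then t uold else if a = uold then none else t a

/-- `R[unew/uold]`: the relation `R` with the attribute `uold` renamed to `unew`. -/
def renameAttr (unew uold : A) (R : Rel A Δ) : Rel A Δ := R.map (renameAttrT unew uold)

/-- `coalesce(v, v') = if(¬isNull(v), v, v')`. -/
def Term.coalesce (v v' : Term A Δ) : Term A Δ := .ite (.not (.isNull [v])) v v'

/-- The filter `⋀_{u ∈ K} ¬isNull(u)`. -/
def notNullAll (K : Finset A) : Filter A Δ :=
  K.toList.foldr (fun u acc => (Filter.not (.isNull [.attr u])).and acc) Filter.tru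

mutual
/-- `nullify_S`: replace every occurrence of an attribute from `S` by the constant null. -/
def Term.nullify (null : Δ) (S : Finset A) : Term A Δ → Term A Δ
  | .attr a => if a ∈ S then .const null else .attr a
  | .const c => .const c
  | .ite F v v' => .ite (F.nullify null S) (v.nullify null S) (v'.nullify null S)

def Term.nullifyList (null : Δ) (S : Finset A) : List (Term A Δ) → List (Term A Δ)
  | [] => []
  | v :: vs => v.nullify null S :: Term.nullifyList null S vs

/-- `nullify_S` on filters. -/
def Filter.nullify (null : Δ) (S : Finset A) : Filter A Δ → Filter A Δ
  | .isNull V => .isNull (Term.nullifyList null S V)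
  | .eq v v' => .eq (v.nullify null S) (v'.nullify null S)
  | .and F1 F2 => .and (F1.nullify null S) (F2.nullify null S)
  | .not F => .not (F.nullify null S)
end

/-- p-equivalence of filters over `U`: they are ⊤ on the same tuples over `U`. -/
def pequiv (null : Δ) (U : Finset A) (F1 F2 : Filter A Δ) : Prop :=
  ∀ t : Tuple A Δ, t.isOver U → (F1.eval null t = TV.tt ↔ F2.eval null t = TV.tt)

end RA
namespace RA

variable {A Δ : Type} [DecidableEq A] [DecidableEq Δ]

mutual
/-- Substitution of terms for attributes in a term. -/
def Term.subst (g : A → Term A Δ) : Term A Δ → Term A Δ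
  | .attr a => g a
  | .const c => .const c
  | .ite F v v' => .ite (F.subst g) (v.subst g) (v'.subst g)

def Term.substList (g : A → Term A Δ) : List (Term A Δ) → List (Term A Δ)
  | [] => []
  | v :: vs => v.subst g :: Term.substList g vs

/-- Substitution of terms for attributes in a filter. -/
def Filter.subst (g : A → Term A Δ) : Filter A Δ → Filter A Δ
  | .isNull V => .isNull (Term.substList g V)
  | .eq v v' => .eq (v.subst g) (v'.subst g)
  | .and F1 F2 => .and (F1.subst g) (F2.subst g)
  | .not F => .not (F.subst g)
end

end RA

namespace SPARQL

open RA

variable {V C : Type} [DecidableEq V] [DecidableEq C]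

/-! ### SPARQL syntax -/

/-- SPARQL filters: `bound(v)`, `(v = c)`, `(v = v')`, conjunction, negation. -/
inductive SFilter (V C : Type) where
  | bound : V → SFilter V C
  | eqc : V → C → SFilter V C
  | eqv : V → V → SFilter V C
  | and : SFilter V C → SFilter V C → SFilter V C
  | not : SFilter V C → SFilter V C

/-- Solution mappings: partial maps from variables to RDF terms. -/
abbrev SMap (V C : Type) := V → Option C

/-- Three-valued evaluation of a SPARQL filter under a solution mapping. -/
def SFilter.eval (s : SMap V C) : SFilter V C → TV
  | .bound v => if (s v).isSome then .tt else .ff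
  | .eqc v c => match s v with
      | none => .unk
      | some d => if d = c then .tt else .ff
  | .eqv v v' => match s v, s v' with
      | some d, some d' => if d = d' then .tt else .ff
      | _, _ => .unk
  | .and F1 F2 => (F1.eval s).and (F2.eval s)
  | .not F => (F.eval s).not

/-- Variables of a SPARQL filter. -/
def SFilter.vars : SFilter V C → Finset V
  | .bound v => {v}
  | .eqc v _ => {v}
  | .eqv v v' => {v, v'}
  | .and F1 F2 => F1.vars ∪ F2.vars
  | .not F => F.vars

/-- Triple patterns: elements of `(C ∪ V) × (C ∪ V) × (C ∪ V)`
(the restriction of the predicate position to `I ∪ V` is part of well-formedness). -/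
abbrev TP (V C : Type) := (C ⊕ V) × (C ⊕ V) × (C ⊕ V)

def patVars : C ⊕ V → Finset V
  | .inl _ => ∅
  | .inr v => {v}

def tpVars (tp : TP V C) : Finset V := patVars tp.1 ∪ patVars tp.2.1 ∪ patVars tp.2.2

/-- Graph patterns. -/
inductive GP (V C : Type) where
  | bgp : Finset (TP V C) → GP V C
  | filter : GP V C → SFilter V C → GP V C
  | bind : GP V C → V → C → GP V C
  | union : GP V C → GP V C → GP V C
  | join : GP V C → GP V C → GP V C
  | opt : GP V C → GP V C → SFilter V C → GP V C
  | minus : GP V C → GP V C → GP V C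
  | proj : GP V C → Finset V → GP V C
  | dist : GP V C → GP V C

/-- `var(P)`: the (output) variables of a graph pattern. -/
def GP.vars : GP V C → Finset V
  | .bgp B => B.sup tpVars
  | .filter P _ => P.vars
  | .bind P v _ => insert v P.vars
  | .union P1 P2 => P1.vars ∪ P2.vars
  | .join P1 P2 => P1.vars ∪ P2.vars
  | .opt P1 P2 _ => P1.vars ∪ P2.vars
  | .minus P1 _ => P1.vars
  | .proj P L => P.vars ∩ L
  | .dist P => P.vars

/-- All variables occurring (syntactically) in a graph pattern. -/
def GP.allVars : GP V C → Finset V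
  | .bgp B => B.sup tpVars
  | .filter P F => P.allVars ∪ F.vars
  | .bind P v _ => insert v P.allVars
  | .union P1 P2 => P1.allVars ∪ P2.allVars
  | .join P1 P2 => P1.allVars ∪ P2.allVars
  | .opt P1 P2 F => P1.allVars ∪ P2.allVars ∪ F.vars
  | .minus P1 P2 => P1.allVars ∪ P2.allVars
  | .proj P L => P.allVars ∪ L
  | .dist P => P.allVars

/-- Well-formedness w.r.t. the set `I` of IRIs: predicates of triple patterns are
IRIs or variables, filters are safe, and `Bind` introduces a fresh variable. -/
def GP.wf (I : Set C) : GP V C → Prop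
  | .bgp B => ∀ tp ∈ B, ∀ c : C, tp.2.1 = Sum.inl c → c ∈ I
  | .filter P F => P.wf I ∧ F.vars ⊆ P.vars
  | .bind P v _ => P.wf I ∧ v ∉ P.allVars
  | .union P1 P2 => P1.wf I ∧ P2.wf I
  | .join P1 P2 => P1.wf I ∧ P2.wf I
  | .opt P1 P2 F => P1.wf I ∧ P2.wf I ∧ F.vars ⊆ P1.vars ∪ P2.vars
  | .minus P1 P2 => P1.wf I ∧ P2.wf I
  | .proj P _ => P.wf I
  | .dist P => P.wf I

/-! ### SPARQL semantics (bag semantics) -/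

/-- An RDF graph: a finite set of triples. -/
abbrev Graph (C : Type) := Finset (C × C × C)

/-- Compatibility of solution mappings. -/
def scompat (s1 s2 : SMap V C) : Prop :=
  ∀ v c1 c2, s1 v = some c1 → s2 v = some c2 → c1 = c2

/-- `s1 ⊕ s2`. -/
def smerge (s1 s2 : SMap V C) : SMap V C := fun v => (s1 v).or (s2 v)

/-- The RDF terms occurring in a graph. -/
def graphTerms (G : Graph C) : Finset C :=
  G.image (fun x => x.1) ∪ G.image (fun x => x.2.1) ∪ G.image (fun x => x.2.2)

/-- All solution mappings with domain `vs` and values in `T`. -/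
noncomputable def mapsOver (vs : Finset V) (T : Finset C) : Finset (SMap V C) :=
  (vs.pi (fun _ => T)).image (fun f v => if h : v ∈ vs then some (f v h) else none)

def tpApply (s : SMap V C) : C ⊕ V → Option C
  | .inl c => some c
  | .inr v => s v

/-- `s(tp) ∈ G`. -/
def tpMatch (s : SMap V C) (tp : TP V C) (G : Graph C) : Prop :=
  ∃ x ∈ G, tpApply s tp.1 = some x.1 ∧ tpApply s tp.2.1 = some x.2.1 ∧
    tpApply s tp.2.2 = some x.2.2

/-- Answers to a BGP: the solution mappings `s` with `dom(s) = var(B)` and `s(B) ⊆ G`,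
each with multiplicity 1. -/
noncomputable def bgpAns (G : Graph C) (B : Finset (TP V C)) : Multiset (SMap V C) :=
  ((mapsOver (B.sup tpVars) (graphTerms G)).filter (fun s => ∀ tp ∈ B, tpMatch s tp G)).val

/-- The bag of answers `⟦P⟧_G` to a graph pattern over an RDF graph. -/
noncomputable def GP.ans (G : Graph C) : GP V C → Multiset (SMap V C)
  | .bgp B => bgpAns G B
  | .filter P F => (P.ans G).filter (fun s => F.eval s = .tt)
  | .bind P v c => (P.ans G).map (fun s w => if w = v then some c else s w)
  | .union P1 P2 => P1.ans G + P2.ans G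
  | .join P1 P2 =>
      ((P1.ans G).product (P2.ans G)).filterMap
        (fun p => if scompat p.1 p.2 then some (smerge p.1 p.2) else none)
  | .opt P1 P2 F =>
      (((P1.ans G).product (P2.ans G)).filterMap
          (fun p => if scompat p.1 p.2 then some (smerge p.1 p.2) else none)).filter
        (fun s => F.eval s = .tt)
      + (P1.ans G).filter
          (fun s => ∀ s2 ∈ P2.ans G, scompat s s2 → F.eval (smerge s s2) ≠ .tt)
  | .minus P1 P2 =>
      (P1.ans G).filter
        (fun s => ∀ s2 ∈ P2.ans G, scompat s s2 → ∀ v, s v = none ∨ s2 v = none)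
  | .proj P L => (P.ans G).map (fun s v => if v ∈ L then s v else none)
  | .dist P => (P.ans G).dedup

/-! ### The translation τ into relational algebra -/

/-- Attributes of the relational queries: variables of `V`, renamed-apart copies `u¹`,`u²`,
the fresh attribute `w` of the `Minus` translation and the attributes `sub`, `pred`, `obj`
of the relation `triple`. -/
abbrev Attr (V : Type) := V ⊕ ((V × Bool) ⊕ (Unit ⊕ Fin 3))

/-- The domain: the RDF terms `C`, the null and one additional non-null constant. -/
abbrev Dom (C : Type) := Option (Option C)

/-- The distinguished null of the domain. -/
def nul : Dom C := none

/-- A fixed non-null domain element (the `1` used in the translation of `Minus`). -/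
def one : Dom C := some none

/-- Embedding of RDF terms into the domain. -/
def emb (c : C) : Dom C := some (some c)

/-- The attribute of a SPARQL variable. -/
def inV (v : V) : Attr V := Sum.inl v

/-- The renamed-apart attributes `u¹` (`b = false`) and `u²` (`b = true`). -/
def ren (b : Bool) (v : V) : Attr V := Sum.inr (Sum.inl (v, b))

/-- The fresh attribute `w` of the `Minus` translation. -/
def wA : Attr V := Sum.inr (Sum.inr (Sum.inl ()))

/-- The attributes `sub`, `pred`, `obj` of the ternary relation `triple`. -/
def posA (i : Fin 3) : Attr V := Sum.inr (Sum.inr (Sum.inr i))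

/-- The data instance `triple(G)` storing `G` as a ternary relation with
attributes `sub`, `pred` and `obj`. -/
def tripleRel (G : Graph C) : RA.Rel (Attr V) (Dom C) :=
  G.val.map (fun x a =>
    if a = posA 0 then some (emb x.1)
    else if a = posA 1 then some (emb x.2.1)
    else if a = posA 2 then some (emb x.2.2) else none)

/-- Selection condition for a constant in a position of a triple pattern. -/
def posConstraint (p : Attr V) : C ⊕ V → RA.Filter (Attr V) (Dom C)
  | .inl c => .eq (.attr p) (.const (emb c))
  | .inr _ => RA.Filter.tru

/-- Selection condition for a repeated variable in two positions of a triple pattern. -/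
def dupConstraint (p q : Attr V) : C ⊕ V → C ⊕ V → RA.Filter (Attr V) (Dom C)
  | .inr v, .inr v' => if v = v' then .eq (.attr p) (.attr q) else RA.Filter.tru
  | _, _ => RA.Filter.tru

/-- The selection condition of the translation of a triple pattern. -/
def tpFilter (tp : TP V C) : RA.Filter (Attr V) (Dom C) :=
  ((((posConstraint (posA 0) tp.1).and (posConstraint (posA 1) tp.2.1)).and
      (posConstraint (posA 2) tp.2.2)).and
    (((dupConstraint (posA 0) (posA 1) tp.1 tp.2.1).and
        (dupConstraint (posA 0) (posA 2) tp.1 tp.2.2)).and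
      (dupConstraint (posA 1) (posA 2) tp.2.1 tp.2.2)))

/-- The first position of a triple pattern in which a variable occurs. -/
def firstPos (tp : TP V C) (v : V) : Attr V :=
  if tp.1 = Sum.inr v then posA 0 else if tp.2.1 = Sum.inr v then posA 1 else posA 2

def posSet : Finset (Attr V) := {posA 0, posA 1, posA 2}

def tpProjTerm (tp : TP V C) : Attr V → RA.Term (Attr V) (Dom C)
  | Sum.inl v => .attr (firstPos tp v)
  | _ => .const nul

/-- τ of a triple pattern: an extended projection of a selection of `triple(G)`. -/
noncomputable def tauTP (G : Graph C) (tp : TP V C) : RA.Rel (Attr V) (Dom C) :=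
  rename nul posSet ((tpVars tp).image inV) (tpProjTerm tp)
    (select nul (tpFilter tp) (tripleRel G))

/-- The relation consisting of the single empty tuple (the unit of natural join). -/
def unitRel : RA.Rel (Attr V) (Dom C) := {(fun _ => none : RA.Tuple (Attr V) (Dom C))}

/-- τ of a BGP: the natural join of the translations of its triple patterns. -/
noncomputable def tauBGP (G : Graph C) (B : Finset (TP V C)) : RA.Rel (Attr V) (Dom C) :=
  B.toList.foldr (fun tp acc => join nul (tauTP G tp) acc) unitRel

/-- Translation of SPARQL filters: `bound(v)` becomes `¬isNull(v)`. -/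
def tauSF : SFilter V C → RA.Filter (Attr V) (Dom C)
  | .bound v => .not (.isNull [.attr (inV v)])
  | .eqc v c => .eq (.attr (inV v)) (.const (emb c))
  | .eqv v v' => .eq (.attr (inV v)) (.attr (inV v'))
  | .and F1 F2 => .and (tauSF F1) (tauSF F2)
  | .not F => .not (tauSF F)

/-- Renaming the shared attributes `U` apart (`ρ_{U¹/U}` for `b = false`,
`ρ_{U²/U}` for `b = true`), at the level of tuples. -/
def renApartT (U : Finset V) (b : Bool) (t : RA.Tuple (Attr V) (Dom C)) :
    RA.Tuple (Attr V) (Dom C) :=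
  fun a => match a with
    | Sum.inl v => if v ∈ U then none else t (Sum.inl v)
    | Sum.inr (Sum.inl (v, b')) =>
        if b' = b ∧ v ∈ U then t (Sum.inl v) else t (Sum.inr (Sum.inl (v, b')))
    | a => t a

def renApart (U : Finset V) (b : Bool) (R : RA.Rel (Attr V) (Dom C)) : RA.Rel (Attr V) (Dom C) :=
  R.map (renApartT U b)

/-- Renaming the attributes `U¹` back to `U` (`ρ_{U/U¹}`), at the level of tuples. -/
def renBackT (U : Finset V) (t : RA.Tuple (Attr V) (Dom C)) : RA.Tuple (Attr V) (Dom C) :=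
  fun a => match a with
    | Sum.inl v => if v ∈ U then t (ren false v) else t (Sum.inl v)
    | Sum.inr (Sum.inl (v, false)) =>
        if v ∈ U then none else t (Sum.inr (Sum.inl (v, false)))
    | a => t a

def renBack (U : Finset V) (R : RA.Rel (Attr V) (Dom C)) : RA.Rel (Attr V) (Dom C) :=
  R.map (renBackT U)

/-- `comp_U = ⋀_{u ∈ U} [(u¹ = u²) ∨ isNull(u¹) ∨ isNull(u²)]`. -/
def compF (U : Finset V) : RA.Filter (Attr V) (Dom C) :=
  U.toList.foldr (fun u acc =>
    ((((RA.Filter.eq (.attr (ren false u)) (.attr (ren true u))).or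
          (.isNull [.attr (ren false u)])).or
        (.isNull [.attr (ren true u)]))).and acc) RA.Filter.tru

/-- `⋁_{u ∈ U} (u¹ = u²)`. -/
def eqDisj (U : Finset V) : RA.Filter (Attr V) (Dom C) :=
  U.toList.foldr (fun u acc =>
    (RA.Filter.eq (.attr (ren false u)) (.attr (ren true u))).or acc)
    (RA.Filter.not RA.Filter.tru)

/-- The substitution `coalesce_U`: each shared `u` becomes `coalesce(u¹, u²)`. -/
def coalSubst (U : Finset V) (a : Attr V) : RA.Term (Attr V) (Dom C) :=
  match a with
  | Sum.inl v =>
      if v ∈ U then RA.Term.coalesce (.attr (ren false v)) (.attr (ren true v))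
      else .attr (Sum.inl v)
  | a => .attr a

/-- `ρ^{U¹ ∪ U²}_{coalesce_U}`: rename each pair `u¹, u²` back into `u` via coalesce. -/
noncomputable def coalesceBack (U : Finset V) (R : RA.Rel (Attr V) (Dom C)) :
    RA.Rel (Attr V) (Dom C) :=
  rename nul (U.image (ren false) ∪ U.image (ren true)) (U.image inV) (coalSubst U) R

/-- Attributes of `ρ_{Uᵇ/U} τ(P)` for a pattern with variables `W` sharing `U`. -/
def renamedAttrs (W U : Finset V) (b : Bool) : Finset (Attr V) :=
  (W \ U).image inV ∪ U.image (ren b)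

/-- The translation τ of graph patterns into relational algebra, evaluated over `triple(G)`. -/
noncomputable def tau (G : Graph C) : GP V C → RA.Rel (Attr V) (Dom C)
  | .bgp B => tauBGP G B
  | .filter P F => select nul (tauSF F) (tau G P)
  | .bind P v c => extend nul (inV v) (.const (emb c)) (tau G P)
  | .union P1 P2 =>
      ounion nul (P1.vars.image inV) (P2.vars.image inV) (tau G P1) (tau G P2)
  | .join P1 P2 =>
      coalesceBack (P1.vars ∩ P2.vars)
        (joinF nul (compF (P1.vars ∩ P2.vars))
          (renApart (P1.vars ∩ P2.vars) false (tau G P1))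
          (renApart (P1.vars ∩ P2.vars) true (tau G P2)))
  | .opt P1 P2 F =>
      coalesceBack (P1.vars ∩ P2.vars)
        (ljoin nul (renamedAttrs P1.vars (P1.vars ∩ P2.vars) false)
          (renamedAttrs P2.vars (P1.vars ∩ P2.vars) true)
          ((compF (P1.vars ∩ P2.vars)).and
            ((tauSF F).subst (coalSubst (P1.vars ∩ P2.vars))))
          (renApart (P1.vars ∩ P2.vars) false (tau G P1))
          (renApart (P1.vars ∩ P2.vars) true (tau G P2)))
  | .minus P1 P2 =>
      proj (P1.vars.image inV)
        (renBack (P1.vars ∩ P2.vars)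
          (select nul (.isNull [.attr wA])
            (ljoin nul (renamedAttrs P1.vars (P1.vars ∩ P2.vars) false)
              (insert wA (renamedAttrs P2.vars (P1.vars ∩ P2.vars) true))
              ((compF (P1.vars ∩ P2.vars)).and (eqDisj (P1.vars ∩ P2.vars)))
              (renApart (P1.vars ∩ P2.vars) false (tau G P1))
              (extend nul wA (.const one)
                (renApart (P1.vars ∩ P2.vars) true (tau G P2))))))
  | .proj P L => proj ((P.vars ∩ L).image inV) (tau G P)
  | .dist P => dedup (tau G P)

/-- `ext_{var(P)}(s)`: represent a solution mapping as a tuple over `var(P)`,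
padding the unbound variables with nulls. -/
def toTuple (vs : Finset V) (s : SMap V C) : RA.Tuple (Attr V) (Dom C) :=
  fun a => match a with
    | Sum.inl v => if v ∈ vs then some ((s v).elim nul emb) else none
    | _ => none

set_option linter.unusedSectionVars false

/-- The domain element representing the value of `s` at `v`, which is null if `v` is unbound. -/
def SMap.val (s : SMap V C) (v : V) : Dom C := (s v).elim nul emb

/-- The domain of the solution mapping `s` is contained in `W`. -/
def SMap.DomIn (s : SMap V C) (W : Finset V) : Prop := ∀ v, v ∉ W → s v = none

theorem SMap.val_eq_val {s s' : SMap V C} {v v' : V} : s.val v = s'.val v' ↔ s v = s' v' := by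
  unfold SMap.val
  cases s v <;> cases s' v' <;> simp [nul, emb]

theorem SMap.val_eq_nul {s : SMap V C} {v : V} : s.val v = nul ↔ s v = none := by
  unfold SMap.val
  cases s v <;> simp [nul, emb]

theorem SMap.DomIn.val {s : SMap V C} {W : Finset V} (h : s.DomIn W) {v : V} (hv : v ∉ W) :
    s.val v = nul := SMap.val_eq_nul.2 (h v hv)

theorem SMap.DomIn.smerge {s₁ s₂ : SMap V C} {W₁ W₂ : Finset V} (h₁ : s₁.DomIn W₁)
    (h₂ : s₂.DomIn W₂) : SMap.DomIn (smerge s₁ s₂) (W₁ ∪ W₂) := by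
  intro v hv
  simp only [Finset.mem_union, not_or] at hv
  simp [SPARQL.smerge, h₁ v hv.1, h₂ v hv.2]

theorem SMap.domIn_empty (W : Finset V) : SMap.DomIn (fun _ => none : SMap V C) W :=
  fun _ _ => rfl

theorem SMap.DomIn.mono {s : SMap V C} {W W' : Finset V} (h : s.DomIn W) (hW : W ⊆ W') :
    s.DomIn W' := fun v hv => h v fun hv' => hv (hW hv')

theorem mem_mapsOver {vs : Finset V} {T : Finset C} {s : SMap V C} :
    s ∈ mapsOver vs T ↔ s.DomIn vs ∧ ∀ v ∈ vs, ∃ c ∈ T, s v = some c := by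
  simp only [mapsOver, Finset.mem_image, Finset.mem_pi]
  constructor
  · rintro ⟨f, hf, rfl⟩
    refine ⟨fun v hv => by simp [hv], fun v hv => ⟨f v hv, hf v hv, by simp [hv]⟩⟩
  · rintro ⟨h, h'⟩
    choose f hf hsf using h'
    refine ⟨f, hf, ?_⟩
    funext v
    by_cases hv : v ∈ vs
    · simp [hv, hsf v hv]
    · simp [hv, h v hv]

theorem GP.domIn_of_mem_ans (G : Graph C) (P : GP V C) :
    ∀ s ∈ P.ans G, SMap.DomIn s P.vars := by
  induction P with
  | bgp B =>
    intro s hs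
    simp only [GP.ans, bgpAns, Finset.mem_val, Finset.mem_filter] at hs
    exact (mem_mapsOver.1 hs.1).1
  | filter P F ih => exact fun s hs => ih s (Multiset.mem_of_mem_filter hs)
  | bind P v c ih =>
    intro s hs
    obtain ⟨s', hs', rfl⟩ := Multiset.mem_map.1 hs
    intro w hw
    simp only [GP.vars, Finset.mem_insert, not_or] at hw
    simp [hw.1, ih s' hs' w hw.2]
  | union P₁ P₂ ih₁ ih₂ =>
    intro s hs
    rcases Multiset.mem_add.1 hs with h | h
    · exact (ih₁ s h).mono Finset.subset_union_left
    · exact (ih₂ s h).mono Finset.subset_union_right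
  | join P₁ P₂ ih₁ ih₂ =>
    intro s hs
    obtain ⟨⟨s₁, s₂⟩, hp, h⟩ := (Multiset.mem_filterMap _ _).1 hs
    have hp := Multiset.mem_product.1 hp
    split_ifs at h
    cases h
    exact (ih₁ s₁ hp.1).smerge (ih₂ s₂ hp.2)
  | opt P₁ P₂ F ih₁ ih₂ =>
    intro s hs
    rcases Multiset.mem_add.1 hs with h | h
    · obtain ⟨⟨s₁, s₂⟩, hp, h⟩ := (Multiset.mem_filterMap _ _).1 (Multiset.mem_of_mem_filter h)
      have hp := Multiset.mem_product.1 hp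
      split_ifs at h
      cases h
      exact (ih₁ s₁ hp.1).smerge (ih₂ s₂ hp.2)
    · exact (ih₁ s (Multiset.mem_of_mem_filter h)).mono Finset.subset_union_left
  | minus P₁ P₂ ih₁ ih₂ => exact fun s hs => ih₁ s (Multiset.mem_of_mem_filter hs)
  | proj P L ih =>
    intro s hs
    obtain ⟨s', hs', rfl⟩ := Multiset.mem_map.1 hs
    intro w hw
    simp only [GP.vars, Finset.mem_inter, not_and] at hw
    by_cases hL : w ∈ L
    · simp [ih s' hs' w fun h => hw h hL]
    · simp [hL]
  | dist P ih => exact fun s hs => ih s (Multiset.mem_dedup.1 hs)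

/-! ### Padded solution mappings -/

theorem toTuple_inV (W : Finset V) (s : SMap V C) (v : V) :
    toTuple W s (inV v) = if v ∈ W then some (s.val v) else none := rfl

theorem toTuple_inl (W : Finset V) (s : SMap V C) (v : V) :
    toTuple W s (Sum.inl v) = if v ∈ W then some (s.val v) else none := rfl

theorem getD_toTuple {W : Finset V} {s : SMap V C} (h : s.DomIn W) (v : V) :
    (toTuple W s (inV v)).getD nul = s.val v := by
  rw [toTuple_inV]
  split_ifs with hv
  · rfl
  · exact (h.val hv).symm

theorem toTuple_injOn {W : Finset V} {s s' : SMap V C} (h : s.DomIn W) (h' : s'.DomIn W)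
    (e : toTuple W s = toTuple W s') : s = s' := by
  funext v
  rw [← SMap.val_eq_val, ← getD_toTuple h, ← getD_toTuple h', e]

theorem dedup_map_toTuple {W : Finset V} {A : Multiset (SMap V C)} (h : ∀ s ∈ A, s.DomIn W) :
    (A.map (toTuple W)).dedup = A.dedup.map (toTuple W) := by
  have hn : (A.dedup.map (toTuple W)).Nodup := A.nodup_dedup.map_on fun s hs s' hs' e =>
    toTuple_injOn (h s (Multiset.mem_dedup.1 hs)) (h s' (Multiset.mem_dedup.1 hs')) e
  rw [← Multiset.dedup_map_dedup_eq, hn.dedup]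

/-! ### Evaluation of filters -/

theorem TV.not_eq_tt {a : TV} : a.not = TV.tt ↔ a = TV.ff := by cases a <;> simp [TV.not]

theorem TV.and_eq_tt {a b : TV} : a.and b = TV.tt ↔ a = TV.tt ∧ b = TV.tt := by
  cases a <;> cases b <;> simp [TV.and]

theorem TV.not_and_not_eq_tt {a b : TV} :
    (a.not.and b.not).not = TV.tt ↔ a = TV.tt ∨ b = TV.tt := by
  cases a <;> cases b <;> simp [TV.and, TV.not]

section Filters

variable (t : RA.Tuple (Attr V) (Dom C))

theorem eval_and_eq_tt (F₁ F₂ : RA.Filter (Attr V) (Dom C)) :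
    (F₁.and F₂).eval nul t = TV.tt ↔ F₁.eval nul t = TV.tt ∧ F₂.eval nul t = TV.tt := by
  rw [RA.Filter.eval, TV.and_eq_tt]

theorem eval_or_eq_tt (F₁ F₂ : RA.Filter (Attr V) (Dom C)) :
    (F₁.or F₂).eval nul t = TV.tt ↔ F₁.eval nul t = TV.tt ∨ F₂.eval nul t = TV.tt := by
  rw [RA.Filter.or, RA.Filter.eval, RA.Filter.eval, RA.Filter.eval, RA.Filter.eval,
    TV.not_and_not_eq_tt]

theorem eval_tru : (RA.Filter.tru : RA.Filter (Attr V) (Dom C)).eval nul t = TV.tt := by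
  simp [RA.Filter.tru, RA.Filter.eval, RA.Term.evalList]

theorem eval_isNull_singleton (x : RA.Term (Attr V) (Dom C)) :
    (RA.Filter.isNull [x]).eval nul t = if x.eval nul t = nul then TV.tt else TV.ff := by
  simp [RA.Filter.eval, RA.Term.evalList]

theorem eval_eq_eq_tt (x y : RA.Term (Attr V) (Dom C)) :
    (RA.Filter.eq x y).eval nul t = TV.tt ↔
      x.eval nul t ≠ nul ∧ x.eval nul t = y.eval nul t := by
  rw [RA.Filter.eval]
  split_ifs with h h' <;> grind

theorem eval_coalesce (x y : RA.Term (Attr V) (Dom C)) :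
    (RA.Term.coalesce x y).eval nul t =
      if x.eval nul t = nul then y.eval nul t else x.eval nul t := by
  rw [RA.Term.coalesce, RA.Term.eval, RA.Filter.eval, eval_isNull_singleton]
  split_ifs with h <;> simp_all [TV.not]

theorem eval_foldr_and {α : Type} (l : List α) (f : α → RA.Filter (Attr V) (Dom C)) :
    (l.foldr (fun u acc => (f u).and acc) RA.Filter.tru).eval nul t = TV.tt ↔
      ∀ u ∈ l, (f u).eval nul t = TV.tt := by
  induction l with
  | nil => simp [eval_tru]
  | cons a l ih => simp [eval_and_eq_tt, ih]

theorem eval_foldr_or {α : Type} (l : List α) (f : α → RA.Filter (Attr V) (Dom C)) :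
    (l.foldr (fun u acc => (f u).or acc) (RA.Filter.not RA.Filter.tru)).eval nul t = TV.tt ↔
      ∃ u ∈ l, (f u).eval nul t = TV.tt := by
  induction l with
  | nil => simp [RA.Filter.eval, eval_tru, TV.not]
  | cons a l ih => simp [eval_or_eq_tt, ih]

theorem eval_compF (U : Finset V) :
    (compF U).eval nul t = TV.tt ↔ ∀ u ∈ U, (t (ren false u)).getD nul = nul ∨
      (t (ren true u)).getD nul = nul ∨
      (t (ren false u)).getD nul = (t (ren true u)).getD nul := by
  rw [compF, eval_foldr_and]
  simp only [Finset.mem_toList, eval_or_eq_tt, eval_eq_eq_tt, eval_isNull_singleton,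
    RA.Term.eval]
  grind

theorem eval_eqDisj (U : Finset V) :
    (eqDisj U).eval nul t = TV.tt ↔ ∃ u ∈ U, (t (ren false u)).getD nul ≠ nul ∧
      (t (ren false u)).getD nul = (t (ren true u)).getD nul := by
  rw [eqDisj, eval_foldr_or]
  simp only [Finset.mem_toList, eval_eq_eq_tt, RA.Term.eval]

variable {t}

theorem eval_tauSF_subst {g : Attr V → RA.Term (Attr V) (Dom C)} {s : SMap V C}
    (h : ∀ v, (g (inV v)).eval nul t = s.val v) (F : SFilter V C) :
    ((tauSF F).subst g).eval nul t = F.eval s := by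
  induction F with
  | bound v =>
    simp only [tauSF, RA.Filter.subst, RA.Term.substList, RA.Term.subst, RA.Filter.eval.eq_4,
      eval_isNull_singleton, h, SMap.val_eq_nul, SFilter.eval]
    cases s v <;> simp [TV.not]
  | eqc v c =>
    simp only [tauSF, RA.Filter.subst, RA.Term.subst, RA.Filter.eval, RA.Term.eval, h,
      SMap.val, SFilter.eval]
    cases s v <;> simp [emb, nul]
  | eqv v v' =>
    simp only [tauSF, RA.Filter.subst, RA.Term.subst, RA.Filter.eval, h,
      SMap.val, SFilter.eval]
    cases s v <;> cases s v' <;> simp [emb, nul]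
  | and F₁ F₂ ih₁ ih₂ => simp only [tauSF, RA.Filter.subst, RA.Filter.eval, SFilter.eval, ih₁, ih₂]
  | not F ih => simp only [tauSF, RA.Filter.subst, RA.Filter.eval, SFilter.eval, ih]

theorem tauSF_subst_attr (F : SFilter V C) :
    (tauSF F).subst RA.Term.attr = tauSF F := by
  induction F <;>
    simp_all [tauSF, RA.Filter.subst, RA.Term.subst, RA.Term.substList]

theorem eval_tauSF_toTuple {W : Finset V} {s : SMap V C} (h : s.DomIn W) (F : SFilter V C) :
    (tauSF F).eval nul (toTuple W s) = F.eval s := by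
  rw [← tauSF_subst_attr F]
  exact eval_tauSF_subst (fun v => by rw [RA.Term.eval, getD_toTuple h]) F

end Filters

/-! ### Joins of images of bags -/

section Joins

variable {α β : Type} {g : α → RA.Tuple (Attr V) (Dom C)} {h : β → RA.Tuple (Attr V) (Dom C)}

theorem product_map_map {γ δ : Type} (f : α → γ) (k : β → δ) (A : Multiset α) (B : Multiset β) :
    (A.map f).product (B.map k) = (A.product B).map (Prod.map f k) := by
  simp only [Multiset.product, Multiset.bind_map, Multiset.map_bind, Multiset.map_map]
  rfl

theorem filter_add_eq_right {p : α → Prop} [DecidablePred p] {A B : Multiset α}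
    (hA : ∀ x ∈ A, ¬ p x) (hB : ∀ x ∈ B, p x) : (A + B).filter p = B := by
  rw [Multiset.filter_add, Multiset.filter_eq_nil.2 hA, Multiset.filter_eq_self.2 hB, zero_add]

theorem filterMap_ite_some {γ : Type} (p : α → Prop) [DecidablePred p] (f : α → γ)
    (A : Multiset α) :
    A.filterMap (fun x => if p x then some (f x) else none) = (A.filter p).map f := by
  rw [Multiset.map_filter_eq_filterMap]

theorem joinF_map_map (hd : ∀ x y a, g x a = none ∨ h y a = none)
    (F : RA.Filter (Attr V) (Dom C)) (A : Multiset α) (B : Multiset β) :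
    joinF nul F (A.map g) (B.map h) =
      ((A.product B).filter fun p => F.eval nul ((g p.1).merge (h p.2)) = TV.tt).map
        fun p => (g p.1).merge (h p.2) := by
  have hc : ∀ x y, Compat nul (g x) (h y) := by
    intro x y a h₁ h₂
    rcases hd x y a with e | e <;> simp [e] at h₁ h₂
  rw [joinF, join, product_map_map, Multiset.filterMap_map, select]
  have : ((fun p : RA.Tuple (Attr V) (Dom C) × RA.Tuple (Attr V) (Dom C) =>
      if Compat nul p.1 p.2 then some (p.1.merge p.2) else none) ∘ Prod.map g h) =
      some ∘ fun p => (g p.1).merge (h p.2) := by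
    funext p
    simp [hc]
  rw [this, Multiset.filterMap_eq_map, Multiset.filter_map]
  rfl

theorem ljoin_map_map {U₁ U₂ : Finset (Attr V)} {A : Multiset α} {B : Multiset β}
    (hg : ∀ x, (g x).isOver U₁) (hh : ∀ y, ∀ a ∈ U₁, h y a = none)
    (hi : ∀ x ∈ A, ∀ x' ∈ A, g x = g x' → x = x') (F : RA.Filter (Attr V) (Dom C)) :
    ljoin nul U₁ U₂ F (A.map g) (B.map h) =
      (((A.product B).filter fun p => F.eval nul ((g p.1).merge (h p.2)) = TV.tt).map
        fun p => (g p.1).merge (h p.2)) +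
      (A.filter fun x => ∀ y ∈ B, F.eval nul ((g x).merge (h y)) ≠ TV.tt).map
        fun x => (g x).pad nul (U₂ \ U₁) := by
  have hgn : ∀ x a, a ∉ U₁ → g x a = none := fun x a ha => by
    rw [← Option.not_isSome_iff_eq_none, hg x a]
    exact ha
  have hd : ∀ x y a, g x a = none ∨ h y a = none := fun x y a => by
    by_cases ha : a ∈ U₁
    · exact .inr (hh y a ha)
    · exact .inl (hgn x a ha)
  have hr : ∀ x y, Tuple.restrict ((g x).merge (h y)) U₁ = g x := fun x y => by
    funext a
    by_cases ha : a ∈ U₁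
    · simp [Tuple.restrict, Tuple.merge, ha, hh y a ha]
    · simp [Tuple.restrict, ha, hgn x a ha]
  rw [ljoin, ounion, joinF_map_map hd]
  congr 1
  · rw [Multiset.map_map]
    refine Multiset.map_congr rfl fun p _ => ?_
    funext a
    have ha : a ∉ U₁ \ (U₁ ∪ U₂) := by grind
    exact if_neg ha
  · have hU : (U₁ ∪ U₂) \ U₁ = U₂ \ U₁ := by grind
    rw [bdiff, Multiset.filter_map, Multiset.map_map, hU]
    refine Multiset.map_congr ?_ fun _ _ => rfl
    refine Multiset.filter_congr fun x hx => ?_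
    simp only [Function.comp, proj, Multiset.map_map, Multiset.mem_map, Multiset.mem_filter, hr]
    constructor
    · intro hn y hy hF
      exact hn ⟨(x, y), ⟨Multiset.mem_product.2 ⟨hx, hy⟩, hF⟩, rfl⟩
    · rintro hn ⟨⟨x', y⟩, ⟨hp, hF⟩, e⟩
      have hp := Multiset.mem_product.1 hp
      obtain rfl := hi _ hp.1 _ hx e
      exact hn y hp.2 hF

end Joins

/-! ### Renaming apart -/

/-- The tuple over `W` representing `s`, with the attributes in `U` renamed apart. -/
def apart (W U : Finset V) (b : Bool) (s : SMap V C) : RA.Tuple (Attr V) (Dom C) :=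
  renApartT U b (toTuple W s)

section Apart

variable {W W₁ W₂ U : Finset V} {b b' : Bool} {s s₁ s₂ : SMap V C} {v : V}

theorem renApart_map_toTuple (A : Multiset (SMap V C)) :
    renApart U b (A.map (toTuple W)) = A.map (apart W U b) := by
  rw [renApart, Multiset.map_map]
  rfl

theorem apart_inV : apart W U b s (inV v) = if v ∈ W \ U then some (s.val v) else none := by
  change (if v ∈ U then none else if v ∈ W then some (s.val v) else none) = _
  grind

theorem apart_ren : apart W U b s (ren b' v) =
    if b' = b ∧ v ∈ U ∧ v ∈ W then some (s.val v) else none := by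
  change (if b' = b ∧ v ∈ U then if v ∈ W then some (s.val v) else none else none) = _
  grind

theorem apart_wA : apart W U b s wA = none := rfl

theorem apart_posA (i : Fin 3) : apart W U b s (posA i) = none := rfl

theorem attr_cases {p : Attr V → Prop} (h₁ : ∀ v, p (inV v)) (h₂ : ∀ b v, p (ren b v))
    (h₃ : p wA) (h₄ : ∀ i, p (posA i)) (a : Attr V) : p a := by
  rcases a with v | ⟨v, b⟩ | _ | i
  exacts [h₁ v, h₂ b v, h₃, h₄ i]

theorem inV_mem_renamedAttrs : (inV v : Attr V) ∈ renamedAttrs W U b ↔ v ∈ W \ U := by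
  simp [renamedAttrs, inV, ren]

theorem ren_mem_renamedAttrs : (ren b' v : Attr V) ∈ renamedAttrs W U b ↔ b' = b ∧ v ∈ U := by
  simp [renamedAttrs, inV, ren]
  grind

theorem wA_notMem_renamedAttrs : (wA : Attr V) ∉ renamedAttrs W U b := by
  simp [renamedAttrs, inV, ren, wA]

theorem posA_notMem_renamedAttrs (i : Fin 3) : (posA i : Attr V) ∉ renamedAttrs W U b := by
  simp [renamedAttrs, inV, ren, posA]

theorem apart_isOver (hU : U ⊆ W) : (apart W U b s).isOver (renamedAttrs W U b) := by
  intro a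
  induction a using attr_cases with
  | h₁ v => rw [apart_inV, inV_mem_renamedAttrs]; split_ifs <;> simp_all
  | h₂ b' v => rw [apart_ren, ren_mem_renamedAttrs]; split_ifs <;> grind
  | h₃ => simp [apart_wA, wA_notMem_renamedAttrs]
  | h₄ i => simp [apart_posA, posA_notMem_renamedAttrs]

theorem apart_eq_none (hU : U ⊆ W) {a : Attr V} (ha : a ∉ renamedAttrs W U b) :
    apart W U b s a = none := by
  rw [← Option.not_isSome_iff_eq_none, apart_isOver hU a]
  exact ha

theorem apart_injOn (h₁ : s₁.DomIn W) (h₂ : s₂.DomIn W)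
    (e : apart W U b s₁ = apart W U b s₂) : s₁ = s₂ := by
  funext v
  by_cases hW : v ∈ W
  · rw [← SMap.val_eq_val]
    by_cases hv : v ∈ U
    · simpa [apart_ren, hv, hW] using congrFun e (ren b v)
    · simpa [apart_inV, hv, hW] using congrFun e (inV v)
  · rw [h₁ v hW, h₂ v hW]

theorem apart_true_eq_none_of_mem {a : Attr V} (ha : a ∈ renamedAttrs W₁ (W₁ ∩ W₂) false) :
    apart W₂ (W₁ ∩ W₂) true s a = none := by
  induction a using attr_cases with
  | h₁ v => rw [inV_mem_renamedAttrs] at ha; rw [apart_inV]; grind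
  | h₂ b' v => rw [ren_mem_renamedAttrs] at ha; rw [apart_ren]; grind
  | h₃ => rfl
  | h₄ i => rfl

variable {t : RA.Tuple (Attr V) (Dom C)}

theorem eval_compF_iff_scompat (h₁ : s₁.DomIn W₁) (h₂ : s₂.DomIn W₂)
    (ht : ∀ v ∈ W₁ ∩ W₂, t (ren false v) = some (s₁.val v) ∧ t (ren true v) = some (s₂.val v)) :
    (compF (W₁ ∩ W₂)).eval nul t = TV.tt ↔ scompat s₁ s₂ := by
  rw [eval_compF]
  constructor
  · intro h v c₁ c₂ e₁ e₂
    have hv : v ∈ W₁ ∩ W₂ := by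
      by_contra hv
      rw [Finset.mem_inter, not_and_or] at hv
      rcases hv with hv | hv
      · simp [h₁ v hv] at e₁
      · simp [h₂ v hv] at e₂
    simpa [ht v hv, SMap.val, e₁, e₂, nul, emb] using h v hv
  · intro h v hv
    rw [(ht v hv).1, (ht v hv).2]
    simp only [Option.getD_some, SMap.val_eq_nul, SMap.val_eq_val]
    cases e₁ : s₁ v <;> cases e₂ : s₂ v <;> simp
    exact h v _ _ e₁ e₂

theorem eval_eqDisj_iff (h₁ : s₁.DomIn W₁) (h₂ : s₂.DomIn W₂) (hc : scompat s₁ s₂)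
    (ht : ∀ v ∈ W₁ ∩ W₂, t (ren false v) = some (s₁.val v) ∧ t (ren true v) = some (s₂.val v)) :
    (eqDisj (W₁ ∩ W₂)).eval nul t = TV.tt ↔ ¬ ∀ v, s₁ v = none ∨ s₂ v = none := by
  rw [eval_eqDisj]
  push Not
  constructor
  · rintro ⟨v, hv, h⟩
    simp only [ht v hv, Option.getD_some, ne_eq, SMap.val_eq_nul, SMap.val_eq_val] at h
    exact ⟨v, h.1, h.2 ▸ h.1⟩
  · rintro ⟨v, e₁, e₂⟩
    have hv : v ∈ W₁ ∩ W₂ :=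
      Finset.mem_inter.2 ⟨not_imp_comm.1 (h₁ v) e₁, not_imp_comm.1 (h₂ v) e₂⟩
    refine ⟨v, hv, ?_⟩
    simp only [ht v hv, Option.getD_some, ne_eq, SMap.val_eq_nul, SMap.val_eq_val]
    obtain ⟨c₁, hc₁⟩ := Option.ne_none_iff_exists'.1 e₁
    obtain ⟨c₂, hc₂⟩ := Option.ne_none_iff_exists'.1 e₂
    exact ⟨e₁, by rw [hc₁, hc₂, hc v _ _ hc₁ hc₂]⟩

theorem val_smerge : SMap.val (smerge s₁ s₂) v =
    if s₁.val v = nul then s₂.val v else s₁.val v := by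
  unfold SMap.val smerge
  cases s₁ v <;> simp [nul, emb]

/-- The tuple obtained by merging the renamed-apart representations of `s₁` and `s₂`. -/
def mergeApart (W₁ W₂ : Finset V) (s₁ s₂ : SMap V C) : RA.Tuple (Attr V) (Dom C) :=
  (apart W₁ (W₁ ∩ W₂) false s₁).merge (apart W₂ (W₁ ∩ W₂) true s₂)

theorem mergeApart_ren (hv : v ∈ W₁ ∩ W₂) :
    mergeApart W₁ W₂ s₁ s₂ (ren false v) = some (s₁.val v) ∧
      mergeApart W₁ W₂ s₁ s₂ (ren true v) = some (s₂.val v) := by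
  have := Finset.mem_inter.1 hv
  simp [mergeApart, Tuple.merge, apart_ren, this]

theorem eval_coalSubst_mergeApart (h₁ : s₁.DomIn W₁) (h₂ : s₂.DomIn W₂) (v : V) :
    (coalSubst (W₁ ∩ W₂) (inV v)).eval nul (mergeApart W₁ W₂ s₁ s₂) =
      SMap.val (smerge s₁ s₂) v := by
  change (if v ∈ W₁ ∩ W₂ then RA.Term.coalesce (.attr (ren false v)) (.attr (ren true v))
      else .attr (inV v) : RA.Term (Attr V) (Dom C)).eval nul _ = _
  rw [val_smerge]
  split_ifs with hv h h
  · simp [eval_coalesce, RA.Term.eval, mergeApart_ren hv, h]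
  · simp [eval_coalesce, RA.Term.eval, mergeApart_ren hv, h]
  all_goals
    rw [RA.Term.eval, mergeApart, Tuple.merge, apart_inV, apart_inV]
    by_cases hv₁ : v ∈ W₁ <;> by_cases hv₂ : v ∈ W₂ <;>
      simp_all [h₁.val, h₂.val]

theorem renameFun_mergeApart (h₁ : s₁.DomIn W₁) (h₂ : s₂.DomIn W₂) :
    renameFun nul ((W₁ ∩ W₂).image (ren false) ∪ (W₁ ∩ W₂).image (ren true))
      ((W₁ ∩ W₂).image inV) (coalSubst (W₁ ∩ W₂)) (mergeApart W₁ W₂ s₁ s₂) =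
    toTuple (W₁ ∪ W₂) (smerge s₁ s₂) := by
  funext a
  rw [renameFun]
  induction a using attr_cases with
  | h₁ v =>
    rw [eval_coalSubst_mergeApart h₁ h₂, toTuple_inV]
    by_cases hv₁ : v ∈ W₁ <;> by_cases hv₂ : v ∈ W₂ <;>
      simp [inV, ren, hv₁, hv₂]
    all_goals
      rw [← inV, mergeApart, Tuple.merge, apart_inV, apart_inV]
      simp [hv₁, hv₂, val_smerge, h₁.val, h₂.val]
  | h₂ b v =>
    cases b <;> by_cases hv : v ∈ W₁ <;>
      simp [inV, ren, hv, mergeApart, Tuple.merge, apart, renApartT, toTuple]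
  | h₃ => simp [inV, ren, wA, mergeApart, Tuple.merge, apart, renApartT, toTuple]
  | h₄ i => simp [inV, ren, posA, mergeApart, Tuple.merge, apart, renApartT, toTuple]

theorem pad_apart : (apart W₁ (W₁ ∩ W₂) false s).pad nul
      (renamedAttrs W₂ (W₁ ∩ W₂) true \ renamedAttrs W₁ (W₁ ∩ W₂) false) =
    mergeApart W₁ W₂ s (fun _ => none) := by
  funext a
  rw [Tuple.pad, mergeApart, Tuple.merge]
  induction a using attr_cases with
  | h₁ v =>
    simp only [Finset.mem_sdiff, inV_mem_renamedAttrs, apart_inV, SMap.val, Finset.mem_inter]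
    grind
  | h₂ b v =>
    simp only [Finset.mem_sdiff, ren_mem_renamedAttrs, apart_ren, SMap.val, Finset.mem_inter]
    grind
  | h₃ => simp [wA_notMem_renamedAttrs, apart_wA]
  | h₄ i => simp [posA_notMem_renamedAttrs, apart_posA]

end Apart

/-! ### Joins, optional parts and differences of graph patterns -/

section Patterns

variable {W₁ W₂ : Finset V} {A₁ A₂ : Multiset (SMap V C)}

theorem coalesceBack_map_mergeApart (h₁ : ∀ s ∈ A₁, s.DomIn W₁) (h₂ : ∀ s ∈ A₂, s.DomIn W₂)
    (p : SMap V C × SMap V C → Prop) [DecidablePred p] :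
    coalesceBack (W₁ ∩ W₂)
        (((A₁.product A₂).filter p).map fun q => mergeApart W₁ W₂ q.1 q.2) =
      (((A₁.product A₂).filter p).map fun q => smerge q.1 q.2).map (toTuple (W₁ ∪ W₂)) := by
  rw [coalesceBack, rename, Multiset.map_map, Multiset.map_map]
  refine Multiset.map_congr rfl fun q hq => ?_
  have hq := Multiset.mem_product.1 (Multiset.mem_of_mem_filter hq)
  exact renameFun_mergeApart (h₁ _ hq.1) (h₂ _ hq.2)

theorem map_toTuple_join (h₁ : ∀ s ∈ A₁, s.DomIn W₁) (h₂ : ∀ s ∈ A₂, s.DomIn W₂) :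
    ((A₁.product A₂).filterMap
        (fun p => if scompat p.1 p.2 then some (smerge p.1 p.2) else none)).map
          (toTuple (W₁ ∪ W₂)) =
      coalesceBack (W₁ ∩ W₂) (joinF nul (compF (W₁ ∩ W₂))
        (renApart (W₁ ∩ W₂) false (A₁.map (toTuple W₁)))
        (renApart (W₁ ∩ W₂) true (A₂.map (toTuple W₂)))) := by
  have hd : ∀ (s s' : SMap V C) a, apart W₁ (W₁ ∩ W₂) false s a = none ∨
      apart W₂ (W₁ ∩ W₂) true s' a = none := fun s s' a => by
    by_cases ha : a ∈ renamedAttrs W₁ (W₁ ∩ W₂) false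
    · exact .inr (apart_true_eq_none_of_mem ha)
    · exact .inl (apart_eq_none Finset.inter_subset_left ha)
  rw [filterMap_ite_some, renApart_map_toTuple, renApart_map_toTuple, joinF_map_map hd,
    ← coalesceBack_map_mergeApart h₁ h₂]
  congr 2
  refine Multiset.filter_congr fun q hq => ?_
  have hq := Multiset.mem_product.1 hq
  exact (eval_compF_iff_scompat (h₁ _ hq.1) (h₂ _ hq.2) fun v hv => mergeApart_ren hv).symm

theorem map_toTuple_opt (F : SFilter V C) (h₁ : ∀ s ∈ A₁, s.DomIn W₁)
    (h₂ : ∀ s ∈ A₂, s.DomIn W₂) :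
    (((A₁.product A₂).filterMap
          (fun p => if scompat p.1 p.2 then some (smerge p.1 p.2) else none)).filter
        (fun s => F.eval s = .tt)
      + A₁.filter
          (fun s => ∀ s2 ∈ A₂, scompat s s2 → F.eval (smerge s s2) ≠ .tt)).map
          (toTuple (W₁ ∪ W₂)) =
      coalesceBack (W₁ ∩ W₂)
        (ljoin nul (renamedAttrs W₁ (W₁ ∩ W₂) false) (renamedAttrs W₂ (W₁ ∩ W₂) true)
          ((compF (W₁ ∩ W₂)).and ((tauSF F).subst (coalSubst (W₁ ∩ W₂))))
          (renApart (W₁ ∩ W₂) false (A₁.map (toTuple W₁)))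
          (renApart (W₁ ∩ W₂) true (A₂.map (toTuple W₂)))) := by
  have hF : ∀ s₁ ∈ A₁, ∀ s₂ ∈ A₂,
      (((compF (W₁ ∩ W₂)).and ((tauSF F).subst (coalSubst (W₁ ∩ W₂)))).eval nul
        (mergeApart W₁ W₂ s₁ s₂) = TV.tt ↔ scompat s₁ s₂ ∧ F.eval (smerge s₁ s₂) = TV.tt) := by
    intro s₁ hs₁ s₂ hs₂
    rw [eval_and_eq_tt, eval_compF_iff_scompat (h₁ _ hs₁) (h₂ _ hs₂) fun v hv => mergeApart_ren hv,
      eval_tauSF_subst (eval_coalSubst_mergeApart (h₁ _ hs₁) (h₂ _ hs₂))]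
  rw [filterMap_ite_some, renApart_map_toTuple, renApart_map_toTuple,
    ljoin_map_map (fun s => apart_isOver Finset.inter_subset_left)
      (fun s a ha => apart_true_eq_none_of_mem ha)
      (fun s hs s' hs' => apart_injOn (h₁ s hs) (h₁ s' hs')),
    coalesceBack, rename, Multiset.map_add, Multiset.map_add]
  congr 1
  · rw [Multiset.filter_map, Multiset.filter_filter]
    refine Eq.trans ?_ (coalesceBack_map_mergeApart h₁ h₂ _).symm
    congr 2
    refine Multiset.filter_congr fun q hq => ?_
    have hq := Multiset.mem_product.1 hq
    exact and_comm.trans (hF _ hq.1 _ hq.2).symm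
  · rw [Multiset.map_map]
    refine Multiset.map_congr ?_ fun s hs => ?_
    · refine Multiset.filter_congr fun s hs => forall₂_congr fun s' hs' => ?_
      exact not_and.symm.trans (not_congr (hF s hs s' hs').symm)
    · have hs := h₁ s (Multiset.mem_of_mem_filter hs)
      rw [Function.comp, pad_apart, renameFun_mergeApart hs (SMap.domIn_empty W₂)]
      congr 1
      funext v
      simp [smerge]

theorem restrict_renBackT {W U : Finset V} {s : SMap V C} {t : RA.Tuple (Attr V) (Dom C)}
    (hU : ∀ v ∈ U, t (ren false v) = some (s.val v))
    (hW : ∀ v ∈ W \ U, t (inV v) = some (s.val v)) :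
    Tuple.restrict (renBackT U t) (W.image inV) = toTuple W s := by
  funext a
  rw [Tuple.restrict]
  induction a using attr_cases with
  | h₁ v =>
    have : renBackT U t (inV v) = if v ∈ U then t (ren false v) else t (inV v) := rfl
    rw [this, toTuple_inV]
    by_cases hv : v ∈ W <;> by_cases hv' : v ∈ U <;> simp_all [inV]
  | h₂ b v => simp [inV, ren, toTuple]
  | h₃ => simp [inV, wA, toTuple]
  | h₄ i => simp [inV, posA, toTuple]

/-- The renamed-apart tuple representing `s`, extended by the attribute `w`. -/
def apartW (W U : Finset V) (s : SMap V C) : RA.Tuple (Attr V) (Dom C) :=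
  fun a => if a = wA then some one else apart W U true s a

theorem map_toTuple_minus (h₁ : ∀ s ∈ A₁, s.DomIn W₁) (h₂ : ∀ s ∈ A₂, s.DomIn W₂) :
    (A₁.filter (fun s => ∀ s2 ∈ A₂, scompat s s2 → ∀ v, s v = none ∨ s2 v = none)).map
        (toTuple W₁) =
      proj (W₁.image inV)
        (renBack (W₁ ∩ W₂)
          (select nul (.isNull [.attr wA])
            (ljoin nul (renamedAttrs W₁ (W₁ ∩ W₂) false)
              (insert wA (renamedAttrs W₂ (W₁ ∩ W₂) true))
              ((compF (W₁ ∩ W₂)).and (eqDisj (W₁ ∩ W₂)))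
              (renApart (W₁ ∩ W₂) false (A₁.map (toTuple W₁)))
              (extend nul wA (.const one)
                (renApart (W₁ ∩ W₂) true (A₂.map (toTuple W₂))))))) := by
  have hext : extend nul wA (.const one) (renApart (W₁ ∩ W₂) true (A₂.map (toTuple W₂))) =
      A₂.map (apartW W₂ (W₁ ∩ W₂)) := by
    rw [renApart_map_toTuple, extend, Multiset.map_map]
    rfl
  have hh : ∀ (s : SMap V C), ∀ a ∈ renamedAttrs W₁ (W₁ ∩ W₂) false,
      apartW W₂ (W₁ ∩ W₂) s a = none := by
    intro s a ha
    have : a ≠ wA := by rintro rfl; exact wA_notMem_renamedAttrs ha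
    rw [apartW, if_neg this, apart_true_eq_none_of_mem ha]
  have hren : ∀ s₁ s₂ : SMap V C, ∀ v ∈ W₁ ∩ W₂,
      (apart W₁ (W₁ ∩ W₂) false s₁).merge (apartW W₂ (W₁ ∩ W₂) s₂) (ren false v) =
        some (s₁.val v) ∧
      (apart W₁ (W₁ ∩ W₂) false s₁).merge (apartW W₂ (W₁ ∩ W₂) s₂) (ren true v) =
        some (s₂.val v) := by
    intro s₁ s₂ v hv
    have hv' := Finset.mem_inter.1 hv
    have hw : ∀ b, (ren b v : Attr V) ≠ wA := by simp [ren, wA]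
    simp [Tuple.merge, apartW, apart_ren, hv', hw]
  rw [renApart_map_toTuple, hext,
    ljoin_map_map (fun s => apart_isOver Finset.inter_subset_left) hh
      (fun s hs s' hs' => apart_injOn (h₁ s hs) (h₁ s' hs')),
    select, filter_add_eq_right]
  · rw [renBack, proj, Multiset.map_map, Multiset.map_map]
    refine Multiset.map_congr ?_ fun s hs => ?_
    · refine Multiset.filter_congr fun s hs => forall₂_congr fun s' hs' => ?_
      rw [ne_eq, eval_and_eq_tt,
        eval_compF_iff_scompat (h₁ _ hs) (h₂ _ hs') (hren s s'), not_and]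
      refine forall_congr' fun hc => ?_
      rw [eval_eqDisj_iff (h₁ _ hs) (h₂ _ hs') hc (hren s s'), not_not]
    · refine (restrict_renBackT (fun v hv => ?_) fun v hv => ?_).symm
      · have hv' := Finset.mem_inter.1 hv
        simp [Tuple.pad, apart_ren, hv', ren_mem_renamedAttrs]
      · simp only [Tuple.pad, apart_inV, if_pos hv, Option.some_or, ite_self]
  · intro t ht
    obtain ⟨q, -, rfl⟩ := Multiset.mem_map.1 ht
    have h : (one : Dom C) ≠ nul := by simp [one, nul]
    simp [eval_isNull_singleton, RA.Term.eval, Tuple.merge, apart_wA, apartW, h]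
  · intro t ht
    obtain ⟨s, -, rfl⟩ := Multiset.mem_map.1 ht
    simp [eval_isNull_singleton, RA.Term.eval, Tuple.pad, wA_notMem_renamedAttrs, apart_wA]

theorem pad_toTuple {W W' : Finset V} {s : SMap V C} (h : s.DomIn W) :
    (toTuple W s).pad nul (W'.image inV \ W.image inV) = toTuple (W ∪ W') s := by
  funext a
  rcases a with v | a
  · by_cases hv : v ∈ W <;> by_cases hv' : v ∈ W' <;>
      simp [Tuple.pad, toTuple_inl, inV, hv, hv', h.val]
  · simp [Tuple.pad, toTuple, inV]

theorem map_toTuple_union (h₁ : ∀ s ∈ A₁, s.DomIn W₁) (h₂ : ∀ s ∈ A₂, s.DomIn W₂) :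
    (A₁ + A₂).map (toTuple (W₁ ∪ W₂)) =
      ounion nul (W₁.image inV) (W₂.image inV) (A₁.map (toTuple W₁)) (A₂.map (toTuple W₂)) := by
  rw [ounion, Multiset.map_add, Multiset.map_map, Multiset.map_map]
  congr 1
  · exact Multiset.map_congr rfl fun s hs => (pad_toTuple (h₁ s hs)).symm
  · refine Multiset.map_congr rfl fun s hs => ?_
    rw [Finset.union_comm]
    exact (pad_toTuple (h₂ s hs)).symm

theorem map_toTuple_bind {W : Finset V} {A : Multiset (SMap V C)} (v : V) (c : C) :
    (A.map (fun s w => if w = v then some c else s w)).map (toTuple (insert v W)) =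
      extend nul (inV v) (.const (emb c)) (A.map (toTuple W)) := by
  rw [extend, Multiset.map_map, Multiset.map_map]
  refine Multiset.map_congr rfl fun s _ => ?_
  funext a
  rcases a with w | a
  · by_cases hw : w = v
    · simp [toTuple, hw, inV, RA.Term.eval]
    · simp [toTuple, hw, inV]
  · simp [toTuple, inV]

theorem map_toTuple_proj {W L : Finset V} {A : Multiset (SMap V C)} :
    (A.map (fun s v => if v ∈ L then s v else none)).map (toTuple (W ∩ L)) =
      proj ((W ∩ L).image inV) (A.map (toTuple W)) := by
  rw [proj, Multiset.map_map, Multiset.map_map]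
  refine Multiset.map_congr rfl fun s _ => ?_
  funext a
  rcases a with w | a
  · by_cases hw : w ∈ L <;> simp [toTuple, hw, inV, Tuple.restrict]
  · simp [toTuple, Tuple.restrict]

end Patterns

/-! ### Basic graph patterns -/

section BasicGraphPatterns

/-- The domain of the solution mapping `s` is exactly `W`. -/
def SMap.DomEq (s : SMap V C) (W : Finset V) : Prop := ∀ v, (s v).isSome ↔ v ∈ W

theorem SMap.DomEq.domIn {s : SMap V C} {W : Finset V} (h : s.DomEq W) : s.DomIn W :=
  fun v hv => by rwa [← Option.not_isSome_iff_eq_none, h v]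

/-- The relation `R` stores, each once, the solution mappings with domain `W` satisfying `Q`. -/
def Represents (R : RA.Rel (Attr V) (Dom C)) (W : Finset V) (Q : SMap V C → Prop) : Prop :=
  R.Nodup ∧ ∀ t, t ∈ R ↔ ∃ s : SMap V C, s.DomEq W ∧ Q s ∧ t = toTuple W s

theorem compat_toTuple_iff {W₁ W₂ : Finset V} {s₁ s₂ : SMap V C} (h₁ : s₁.DomEq W₁) :
    Compat nul (toTuple W₁ s₁) (toTuple W₂ s₂) ↔ ∀ v ∈ W₁ ∩ W₂, s₁ v = s₂ v := by
  constructor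
  · intro h v hv
    rw [Finset.mem_inter] at hv
    have := (h (inV v) (by simp [toTuple_inV, hv]) (by simp [toTuple_inV, hv])).1
    simpa [toTuple_inV, hv, SMap.val_eq_val] using this
  · intro h a ha₁ ha₂
    rcases a with v | a
    · have hv₁ : v ∈ W₁ := by by_contra hv; simp [toTuple_inl, hv] at ha₁
      have hv₂ : v ∈ W₂ := by by_contra hv; simp [toTuple_inl, hv] at ha₂
      have hs := (h₁ v).2 hv₁
      rw [toTuple_inl, toTuple_inl, if_pos hv₁, if_pos hv₂, Option.some_inj, Option.some_inj.ne,
        SMap.val_eq_val, ne_eq, SMap.val_eq_nul]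
      exact ⟨h v (Finset.mem_inter.2 ⟨hv₁, hv₂⟩), Option.isSome_iff_ne_none.1 hs⟩
    · simp [toTuple] at ha₁

theorem merge_toTuple {W₁ W₂ : Finset V} {s₁ s₂ : SMap V C} (h₁ : s₁.DomEq W₁) :
    (toTuple W₁ s₁).merge (toTuple W₂ s₂) = toTuple (W₁ ∪ W₂) (smerge s₁ s₂) := by
  funext a
  rcases a with v | a
  · rw [Tuple.merge, toTuple_inl, toTuple_inl, toTuple_inl, val_smerge]
    by_cases hv : v ∈ W₁
    · have := Option.isSome_iff_ne_none.1 ((h₁ v).2 hv)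
      simp [hv, SMap.val_eq_nul, this]
    · simp [hv, h₁.domIn.val hv]
  · simp [Tuple.merge, toTuple]

theorem smerge_eq_left {W₁ : Finset V} {s₁ s₂ : SMap V C} (h₁ : s₁.DomEq W₁) {v : V}
    (hv : v ∈ W₁) : smerge s₁ s₂ v = s₁ v := by
  obtain ⟨c, hc⟩ := Option.isSome_iff_exists.1 ((h₁ v).2 hv)
  simp [smerge, hc]

theorem smerge_eq_right {W₁ W₂ : Finset V} {s₁ s₂ : SMap V C} (h₁ : s₁.DomEq W₁)
    (h : ∀ v ∈ W₁ ∩ W₂, s₁ v = s₂ v) {v : V} (hv : v ∈ W₂) : smerge s₁ s₂ v = s₂ v := by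
  by_cases hv₁ : v ∈ W₁
  · rw [smerge_eq_left h₁ hv₁, h v (Finset.mem_inter.2 ⟨hv₁, hv⟩)]
  · simp [smerge, h₁.domIn v hv₁]

theorem SMap.DomEq.smerge {W₁ W₂ : Finset V} {s₁ s₂ : SMap V C} (h₁ : s₁.DomEq W₁)
    (h₂ : s₂.DomEq W₂) : SMap.DomEq (smerge s₁ s₂) (W₁ ∪ W₂) := fun v => by
  simp [SPARQL.smerge, Finset.mem_union, h₁ v, h₂ v]

theorem SMap.DomEq.ext {W : Finset V} {s s' : SMap V C} (h : s.DomEq W) (h' : s'.DomEq W)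
    (e : ∀ v ∈ W, s v = s' v) : s = s' := by
  funext v
  by_cases hv : v ∈ W
  · exact e v hv
  · rw [h.domIn v hv, h'.domIn v hv]

theorem Represents.join {R₁ R₂ : RA.Rel (Attr V) (Dom C)} {W₁ W₂ : Finset V}
    {Q₁ Q₂ : SMap V C → Prop} (h₁ : Represents R₁ W₁ Q₁) (h₂ : Represents R₂ W₂ Q₂)
    (hQ₁ : ∀ s s', (∀ v ∈ W₁, s v = s' v) → Q₁ s → Q₁ s')
    (hQ₂ : ∀ s s', (∀ v ∈ W₂, s v = s' v) → Q₂ s → Q₂ s') :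
    Represents (RA.join nul R₁ R₂) (W₁ ∪ W₂) (fun s => Q₁ s ∧ Q₂ s) := by
  rw [RA.join, filterMap_ite_some]
  refine ⟨Multiset.Nodup.map_on ?_ ((h₁.1.product h₂.1).filter _), fun t => ?_⟩
  · rintro ⟨t₁, t₂⟩ ht ⟨t₁', t₂'⟩ ht' e
    rw [Multiset.mem_filter] at ht ht'
    have hm := Multiset.mem_product.1 ht.1
    have hm' := Multiset.mem_product.1 ht'.1
    obtain ⟨s₁, hs₁, -, rfl⟩ := (h₁.2 _).1 hm.1
    obtain ⟨s₂, hs₂, -, rfl⟩ := (h₂.2 _).1 hm.2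
    obtain ⟨s₁', hs₁', -, rfl⟩ := (h₁.2 _).1 hm'.1
    obtain ⟨s₂', hs₂', -, rfl⟩ := (h₂.2 _).1 hm'.2
    have hc := (compat_toTuple_iff hs₁).1 ht.2
    have hc' := (compat_toTuple_iff hs₁').1 ht'.2
    rw [merge_toTuple hs₁, merge_toTuple hs₁'] at e
    have e := toTuple_injOn (hs₁.smerge hs₂).domIn (hs₁'.smerge hs₂').domIn e
    have e₁ : s₁ = s₁' := hs₁.ext hs₁' fun v hv => by
      rw [← smerge_eq_left hs₁ hv, e, smerge_eq_left hs₁' hv]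
    have e₂ : s₂ = s₂' := hs₂.ext hs₂' fun v hv => by
      rw [← smerge_eq_right hs₁ hc hv, e, smerge_eq_right hs₁' hc' hv]
    rw [e₁, e₂]
  · rw [Multiset.mem_map]
    constructor
    · rintro ⟨⟨t₁, t₂⟩, ht, rfl⟩
      rw [Multiset.mem_filter] at ht
      have hm := Multiset.mem_product.1 ht.1
      obtain ⟨s₁, hs₁, hq₁, rfl⟩ := (h₁.2 _).1 hm.1
      obtain ⟨s₂, hs₂, hq₂, rfl⟩ := (h₂.2 _).1 hm.2
      have hc := (compat_toTuple_iff hs₁).1 ht.2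
      exact ⟨smerge s₁ s₂, hs₁.smerge hs₂,
        ⟨hQ₁ _ _ (fun v hv => (smerge_eq_left hs₁ hv).symm) hq₁,
          hQ₂ _ _ (fun v hv => (smerge_eq_right hs₁ hc hv).symm) hq₂⟩, merge_toTuple hs₁⟩
    · rintro ⟨s, hs, ⟨hq₁, hq₂⟩, rfl⟩
      have hr : ∀ W ⊆ W₁ ∪ W₂, SMap.DomEq (fun v => if v ∈ W then s v else none) W := by
        intro W hW v
        by_cases hv : v ∈ W
        · simp [hv, (hs v).2 (hW hv)]
        · simp [hv]
      have hr₁ := hr W₁ Finset.subset_union_left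
      have hr₂ := hr W₂ Finset.subset_union_right
      refine ⟨(toTuple W₁ fun v => if v ∈ W₁ then s v else none,
        toTuple W₂ fun v => if v ∈ W₂ then s v else none), ?_, ?_⟩
      · refine Multiset.mem_filter.2 ⟨Multiset.mem_product.2
          ⟨(h₁.2 _).2 ⟨_, hr₁, hQ₁ _ _ (fun v hv => by simp [hv]) hq₁, rfl⟩,
            (h₂.2 _).2 ⟨_, hr₂, hQ₂ _ _ (fun v hv => by simp [hv]) hq₂, rfl⟩⟩, ?_⟩
        rw [compat_toTuple_iff hr₁]
        intro v hv
        rw [Finset.mem_inter] at hv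
        simp [hv]
      · rw [merge_toTuple hr₁]
        congr 1
        refine (hr₁.smerge hr₂).ext hs fun v hv => ?_
        by_cases hv₁ : v ∈ W₁
        · rw [smerge_eq_left hr₁ hv₁, if_pos hv₁]
        · simpa [smerge, hv₁] using fun h => (hs.domIn v (by simp [hv₁, h])).symm

/-- The tuple storing the triple `x`. -/
def tripleTuple (x : C × C × C) : RA.Tuple (Attr V) (Dom C) := fun a =>
  if a = posA 0 then some (emb x.1)
  else if a = posA 1 then some (emb x.2.1)
  else if a = posA 2 then some (emb x.2.2) else none

/-- The solution mapping with domain `var(tp)` read off the triple `x`. -/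
def tripleMap (tp : TP V C) (x : C × C × C) : SMap V C := fun v =>
  if v ∈ tpVars tp then
    some (if tp.1 = Sum.inr v then x.1 else if tp.2.1 = Sum.inr v then x.2.1 else x.2.2)
  else none

/-- `s` maps the triple pattern `tp` to the triple `x`. -/
def TripleMatch (s : SMap V C) (tp : TP V C) (x : C × C × C) : Prop :=
  tpApply s tp.1 = some x.1 ∧ tpApply s tp.2.1 = some x.2.1 ∧ tpApply s tp.2.2 = some x.2.2

theorem mem_patVars {p : C ⊕ V} {v : V} : v ∈ patVars p ↔ p = Sum.inr v := by
  cases p <;> simp [patVars, eq_comm]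

theorem mem_tpVars {tp : TP V C} {v : V} :
    v ∈ tpVars tp ↔ tp.1 = Sum.inr v ∨ tp.2.1 = Sum.inr v ∨ tp.2.2 = Sum.inr v := by
  simp [tpVars, mem_patVars]

theorem tripleMap_domEq (tp : TP V C) (x : C × C × C) : (tripleMap tp x).DomEq (tpVars tp) := by
  intro v
  by_cases hv : v ∈ tpVars tp <;> simp [tripleMap, hv]

theorem TripleMatch.eq_tripleMap {s : SMap V C} {tp : TP V C} {x : C × C × C}
    (h : TripleMatch s tp x) (hs : s.DomEq (tpVars tp)) : s = tripleMap tp x := by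
  refine hs.ext (tripleMap_domEq tp x) fun v hv => ?_
  obtain ⟨h₁, h₂, h₃⟩ := h
  rw [tripleMap, if_pos hv]
  have hv := mem_tpVars.1 hv
  split_ifs with e₁ e₂
  · simpa [e₁, tpApply] using h₁
  · simpa [e₂, tpApply] using h₂
  · simpa [(hv.resolve_left e₁).resolve_left e₂, tpApply] using h₃

theorem eval_tpFilter_tripleTuple (tp : TP V C) (x : C × C × C) :
    (tpFilter tp).eval nul (tripleTuple x) = TV.tt ↔ TripleMatch (tripleMap tp x) tp x := by
  have e₀ : (tripleTuple x (posA 0 : Attr V)) = some (emb x.1) := by simp [tripleTuple]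
  have e₁ : (tripleTuple x (posA 1 : Attr V)) = some (emb x.2.1) := by simp [tripleTuple, posA]
  have e₂ : (tripleTuple x (posA 2 : Attr V)) = some (emb x.2.2) := by simp [tripleTuple, posA]
  have hn : ∀ c : C, emb c ≠ nul := by simp [emb, nul]
  have hi : ∀ c d : C, emb c = emb d ↔ c = d := by simp [emb]
  obtain ⟨p, q, r⟩ := tp
  obtain ⟨a, b, c⟩ := x
  simp only [tpFilter, eval_and_eq_tt, TripleMatch]
  have hpos : ∀ (i : Attr V) (d : C) (o : C ⊕ V), tripleTuple (a, b, c) i = some (emb d) →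
      ((posConstraint i o).eval nul (tripleTuple (a, b, c)) = TV.tt ↔
        ∀ k, o = Sum.inl k → d = k) := by
    intro i d o hd
    cases o <;> simp [posConstraint, eval_tru, eval_eq_eq_tt, RA.Term.eval, hd, hn, hi]
  have hdup : ∀ (i j : Attr V) (d d' : C) (o o' : C ⊕ V),
      tripleTuple (a, b, c) i = some (emb d) → tripleTuple (a, b, c) j = some (emb d') →
      ((dupConstraint i j o o').eval nul (tripleTuple (a, b, c)) = TV.tt ↔
        ∀ v, o = Sum.inr v → o' = Sum.inr v → d = d') := by
    intro i j d d' o o' hd hd'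
    rcases o with k | v <;> rcases o' with k' | v' <;> simp only [dupConstraint]
    case inr.inr =>
      split_ifs with hv
      · simp [eval_eq_eq_tt, RA.Term.eval, hd, hd', hn, hi, hv]
      · simp [eval_tru]
        grind
    all_goals simp [eval_tru]
  rw [hpos _ _ p e₀, hpos _ _ q e₁, hpos _ _ r e₂, hdup _ _ _ _ p q e₀ e₁, hdup _ _ _ _ p r e₀ e₂,
    hdup _ _ _ _ q r e₁ e₂]
  rcases p with k | v <;> rcases q with k' | v' <;> rcases r with k'' | v'' <;>
    simp [tpApply, tripleMap, mem_tpVars] <;> grind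

theorem renameFun_tripleTuple (tp : TP V C) (x : C × C × C) :
    renameFun nul posSet ((tpVars tp).image inV) (tpProjTerm tp) (tripleTuple x) =
      toTuple (tpVars tp) (tripleMap tp x) := by
  funext a
  rw [renameFun]
  induction a using attr_cases with
  | h₁ v =>
    by_cases hv : v ∈ tpVars tp
    · rw [if_pos (Finset.mem_image_of_mem _ hv), toTuple_inV, if_pos hv]
      change some ((RA.Term.attr (firstPos tp v)).eval nul _) = _
      rw [RA.Term.eval, SMap.val, tripleMap, if_pos hv, firstPos]
      split_ifs <;> simp [tripleTuple, posA]
    · simp [inV, posA, posSet, tripleTuple, toTuple, hv]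
  | h₂ b v => simp [inV, ren, posA, posSet, tripleTuple, toTuple]
  | h₃ => simp [inV, wA, posA, posSet, tripleTuple, toTuple]
  | h₄ i =>
    have : (posA i : Attr V) ∈ posSet := by fin_cases i <;> simp [posSet]
    rw [if_neg (by simp [inV, posA]), if_pos this]
    rfl

theorem represents_tauTP (G : Graph C) (tp : TP V C) :
    Represents (tauTP G tp) (tpVars tp) (fun s => tpMatch s tp G) := by
  have e : tauTP G tp = (G.val.filter fun x => TripleMatch (tripleMap tp x) tp x).map
      fun x => toTuple (tpVars tp) (tripleMap tp x) := by
    have hT : tripleRel (V := V) G = G.val.map tripleTuple := rfl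
    rw [tauTP, select, hT, Multiset.filter_map, rename, Multiset.map_map]
    exact Multiset.map_congr (Multiset.filter_congr fun x _ => eval_tpFilter_tripleTuple tp x)
      fun x _ => renameFun_tripleTuple tp x
  rw [e]
  refine ⟨Multiset.Nodup.map_on ?_ (G.nodup.filter _), fun t => ?_⟩
  · intro x hx y hy h
    have hx := (Multiset.mem_filter.1 hx).2
    have hy := (Multiset.mem_filter.1 hy).2
    have h := toTuple_injOn (tripleMap_domEq tp x).domIn (tripleMap_domEq tp y).domIn h
    rw [← h] at hy
    refine Prod.ext ?_ (Prod.ext ?_ ?_)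
    · exact Option.some_inj.1 (hx.1.symm.trans hy.1)
    · exact Option.some_inj.1 (hx.2.1.symm.trans hy.2.1)
    · exact Option.some_inj.1 (hx.2.2.symm.trans hy.2.2)
  · rw [Multiset.mem_map]
    constructor
    · rintro ⟨x, hx, rfl⟩
      have hx := Multiset.mem_filter.1 hx
      exact ⟨_, tripleMap_domEq tp x, ⟨x, hx.1, hx.2⟩, rfl⟩
    · rintro ⟨s, hs, ⟨x, hx, hm⟩, rfl⟩
      have hm : TripleMatch s tp x := hm
      have h := hm.eq_tripleMap hs
      exact ⟨x, Multiset.mem_filter.2 ⟨hx, h ▸ hm⟩, by rw [← h]⟩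

theorem tpMatch_congr {G : Graph C} {tp : TP V C} {s s' : SMap V C}
    (h : ∀ v ∈ tpVars tp, s v = s' v) (hs : tpMatch s tp G) : tpMatch s' tp G := by
  have key : ∀ o : C ⊕ V, (∀ v, o = Sum.inr v → s v = s' v) → tpApply s o = tpApply s' o := by
    rintro (c | v) ho
    · rfl
    · exact ho v rfl
  have h₁ := key tp.1 fun v hv => h v (mem_tpVars.2 (.inl hv))
  have h₂ := key tp.2.1 fun v hv => h v (mem_tpVars.2 (.inr (.inl hv)))
  have h₃ := key tp.2.2 fun v hv => h v (mem_tpVars.2 (.inr (.inr hv)))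
  simpa only [tpMatch, h₁, h₂, h₃] using hs

theorem represents_foldr_join (G : Graph C) (l : List (TP V C)) :
    Represents (l.foldr (fun tp acc => RA.join nul (tauTP G tp) acc) unitRel)
      (l.toFinset.sup tpVars) (fun s => ∀ tp ∈ l, tpMatch s tp G) := by
  induction l with
  | nil =>
    refine ⟨Multiset.nodup_singleton _, fun t => ?_⟩
    have ht : ∀ s : SMap V C, toTuple ∅ s = fun _ => none := fun s => by
      funext a
      cases a <;> simp [toTuple]
    simp only [List.foldr_nil, unitRel, Multiset.mem_singleton, List.toFinset_nil,
      Finset.sup_empty, Finset.bot_eq_empty, ht]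
    exact ⟨fun h => ⟨fun _ => none, fun v => by simp, by simp, h⟩, fun ⟨_, _, _, h⟩ => h⟩
  | cons tp l ih =>
    rw [List.toFinset_cons, Finset.sup_insert, List.foldr_cons]
    simp only [List.forall_mem_cons]
    refine (represents_tauTP G tp).join ih (fun s s' h => tpMatch_congr h) fun s s' h hs tp' ht => ?_
    exact tpMatch_congr (fun v hv => h v
      (Finset.mem_sup.2 ⟨tp', List.mem_toFinset.2 ht, hv⟩)) (hs tp' ht)

theorem mem_graphTerms {G : Graph C} {s : SMap V C} {tp : TP V C} (h : tpMatch s tp G) {v : V}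
    (hv : v ∈ tpVars tp) : ∃ c ∈ graphTerms G, s v = some c := by
  obtain ⟨x, hx, h₁, h₂, h₃⟩ := h
  simp only [graphTerms, Finset.mem_union, Finset.mem_image]
  rcases mem_tpVars.1 hv with e | e | e
  · exact ⟨x.1, .inl (.inl ⟨x, hx, rfl⟩), by simpa [e, tpApply] using h₁⟩
  · exact ⟨x.2.1, .inl (.inr ⟨x, hx, rfl⟩), by simpa [e, tpApply] using h₂⟩
  · exact ⟨x.2.2, .inr ⟨x, hx, rfl⟩, by simpa [e, tpApply] using h₃⟩

theorem map_toTuple_bgpAns (G : Graph C) (B : Finset (TP V C)) :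
    (bgpAns G B).map (toTuple (B.sup tpVars)) = tauBGP G B := by
  have hr := represents_foldr_join G B.toList
  rw [Finset.toList_toFinset, ← tauBGP] at hr
  have hd : ∀ s ∈ bgpAns G B, s.DomIn (B.sup tpVars) := (GP.bgp B).domIn_of_mem_ans G
  refine (Multiset.Nodup.ext (Multiset.Nodup.map_on (fun s hs s' hs' =>
    toTuple_injOn (hd s hs) (hd s' hs')) (Finset.nodup _)) hr.1).2 fun t => ?_
  rw [hr.2, Multiset.mem_map]
  refine exists_congr fun s => ?_
  rw [bgpAns, Finset.mem_val, Finset.mem_filter, mem_mapsOver, ← and_assoc]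
  refine and_congr ?_ eq_comm
  simp only [Finset.mem_toList]
  refine and_congr_left fun hm => ⟨fun h v => ?_, fun h => ⟨h.domIn, fun v hv => ?_⟩⟩
  · constructor
    · intro hs
      by_contra hv
      simp [h.1 v hv] at hs
    · intro hv
      obtain ⟨c, -, hc⟩ := h.2 v hv
      simp [hc]
  · obtain ⟨tp, htp, hv⟩ := Finset.mem_sup.1 hv
    exact mem_graphTerms (hm tp htp) hv

end BasicGraphPatterns

/-- for every RDF graph `G` and every graph pattern `P`,
the relational answer `‖P‖_G` (the padded representation of `⟦P⟧_G` as a bag of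
tuples over `var(P)`) equals the answer `‖τ(P)‖_{triple(G)}` to the translated
relational-algebra query. -/
theorem sparql_to_sql (I : Set C) (G : Graph C) (P : GP V C)
    (hG : ∀ x ∈ G, x.2.1 ∈ I) (hP : P.wf I) :
    (P.ans G).map (toTuple P.vars) = tau G P := by
  clear hG hP
  induction P with
  | bgp B => exact map_toTuple_bgpAns G B
  | filter P F ih =>
    rw [tau, ← ih, select, Multiset.filter_map]
    refine Multiset.map_congr (Multiset.filter_congr fun s hs => ?_) fun _ _ => rfl
    rw [Function.comp, eval_tauSF_toTuple (P.domIn_of_mem_ans G s hs)]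
  | bind P v c ih => rw [tau, ← ih]; exact map_toTuple_bind v c
  | union P₁ P₂ ih₁ ih₂ =>
    rw [tau, ← ih₁, ← ih₂]
    exact map_toTuple_union (P₁.domIn_of_mem_ans G) (P₂.domIn_of_mem_ans G)
  | join P₁ P₂ ih₁ ih₂ =>
    rw [tau, ← ih₁, ← ih₂]
    exact map_toTuple_join (P₁.domIn_of_mem_ans G) (P₂.domIn_of_mem_ans G)
  | opt P₁ P₂ F ih₁ ih₂ =>
    rw [tau, ← ih₁, ← ih₂]
    exact map_toTuple_opt F (P₁.domIn_of_mem_ans G) (P₂.domIn_of_mem_ans G)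
  | minus P₁ P₂ ih₁ ih₂ =>
    rw [tau, ← ih₁, ← ih₂]
    exact map_toTuple_minus (P₁.domIn_of_mem_ans G) (P₂.domIn_of_mem_ans G)
  | proj P L ih => rw [tau, ← ih]; exact map_toTuple_proj
  | dist P ih =>
    rw [tau, ← ih]
    exact (dedup_map_toTuple (P.domIn_of_mem_ans G)).symm

end SPARQL
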